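/- Let A ∈ ℝ^{n×d} have thin SVD A = UΣVᵀ, let 1 ≤ k < rank(A), let U_k ∈ ℝ^{n×k} consist of the top k left singular vectors of A, and let A_{k,⊥} = A − A_k. Define sampling probabilities p_i = (1/2)‖(U_k)_{i*}‖₂²/k + (1/2)‖(A_{k,⊥})_{i*}‖₂²/‖A_{k,⊥}‖_F² for i = 1,…,n, and let W ∈ ℝ^{s×n} be the random sampling-and-rescaling matrix of Algorithm 1 built from these probabilities. Let ε ∈ (0,1) and δ ∈ (0,1). If s ≥ (1 + ε/3) · 4k ln(16(1+k)/δ) / ε², then P(‖U_kᵀ Wᵀ W U_k − I_k‖₂ ≥ ε) ≤ δ/4. -/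

import Mathlib

open Matrix BigOperators

noncomputable def frobNorm {m n : Type*} [Fintype m] [Fintype n]
    (A : Matrix m n ℝ) : ℝ := Real.sqrt (∑ i, ∑ j, (A i j) ^ 2)

noncomputable def specNorm {m n : ℕ} (A : Matrix (Fin m) (Fin n) ℝ) : ℝ :=
  ‖LinearMap.toContinuousLinearMap (Matrix.toEuclideanLin A)‖

noncomputable def truncDiag {r : ℕ} (σ : Fin r → ℝ) (m : ℕ) :
    Matrix (Fin r) (Fin r) ℝ :=
  Matrix.diagonal fun i => if (i : ℕ) < m then σ i else 0

noncomputable def samplingMatrix {n : ℕ} (p : Fin n → ℝ) (s : ℕ) (ω : Fin s → Fin n) :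
    Matrix (Fin s) (Fin n) ℝ :=
  fun i j => if j = ω i then 1 / Real.sqrt (s * p j) else 0

noncomputable def expec {n s : ℕ} (p : Fin n → ℝ) (f : (Fin s → Fin n) → ℝ) : ℝ :=
  ∑ ω : Fin s → Fin n, (∏ i, p (ω i)) * f ω

open Classical in
noncomputable def probOf {n s : ℕ} (p : Fin n → ℝ) (E : (Fin s → Fin n) → Prop) : ℝ :=
  ∑ ω : Fin s → Fin n, if E ω then (∏ i, p (ω i)) else 0

def firstCols {n r : ℕ} (U : Matrix (Fin n) (Fin r) ℝ) (k : ℕ) (h : k ≤ r) :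
    Matrix (Fin n) (Fin k) ℝ :=
  fun i j => U i (Fin.castLE h j)

noncomputable def ridgeDiag {r : ℕ} (σ : Fin r → ℝ) (lam : ℝ) :
    Matrix (Fin r) (Fin r) ℝ :=
  Matrix.diagonal fun i => σ i / Real.sqrt (σ i ^ 2 + lam)

open Filter Topology
open NormedSpace (exp)

section LieTrotter

variable {𝔸 : Type*} [NormedRing 𝔸] [NormOneClass 𝔸]

theorem norm_exp_le_exp_norm [NormedAlgebra ℝ 𝔸] (x : 𝔸) : ‖exp x‖ ≤ Real.exp ‖x‖ := by
  rw [congrFun (NormedSpace.exp_eq_tsum ℝ) x, Real.exp_eq_exp_ℝ,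
    congrFun (NormedSpace.exp_eq_tsum ℝ) ‖x‖]
  refine tsum_of_norm_bounded (NormedSpace.expSeries_summable' (𝕂 := ℝ) ‖x‖).hasSum fun n => ?_
  rw [norm_smul, smul_eq_mul, Real.norm_of_nonneg (by positivity)]
  gcongr
  exact norm_pow_le x n

theorem norm_pow_sub_pow_le {x y : 𝔸} {M : ℝ} (hM : 1 ≤ M) (hx : ‖x‖ ≤ M) (hy : ‖y‖ ≤ M) (n : ℕ) :
    ‖x ^ n - y ^ n‖ ≤ n * M ^ n * ‖x - y‖ := by
  induction n with
  | zero => simp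
  | succ n ih =>
    have key : x ^ (n + 1) - y ^ (n + 1) = x ^ n * (x - y) + (x ^ n - y ^ n) * y := by
      simp only [pow_succ]; noncomm_ring
    have hxn : ‖x ^ n‖ ≤ M ^ n := (norm_pow_le x n).trans (by gcongr)
    calc ‖x ^ (n + 1) - y ^ (n + 1)‖
        ≤ ‖x ^ n‖ * ‖x - y‖ + ‖x ^ n - y ^ n‖ * ‖y‖ := by
          rw [key]
          exact (norm_add_le _ _).trans (add_le_add (norm_mul_le _ _) (norm_mul_le _ _))
      _ ≤ (M ^ n * M) * ‖x - y‖ + (n * M ^ n * ‖x - y‖) * M := by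
          gcongr
          exact hxn.trans (le_mul_of_one_le_right (by positivity) hM)
      _ = (n + 1 : ℕ) * M ^ (n + 1) * ‖x - y‖ := by push_cast; ring

/-- The Lie product formula. -/
theorem tendsto_exp_mul_exp_pow [NormedAlgebra ℝ 𝔸] [CompleteSpace 𝔸] (A B : 𝔸) :
    Tendsto (fun n : ℕ => (exp ((n : ℝ)⁻¹ • A) * exp ((n : ℝ)⁻¹ • B)) ^ n) atTop
      (𝓝 (exp (A + B))) := by
  set f : ℝ → 𝔸 := fun t => exp (t • A) * exp (t • B) - exp (t • (A + B)) with hf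
  have hderiv : HasDerivAt f 0 0 := by
    have h := ((hasDerivAt_exp_smul_const (𝕂 := ℝ) A 0).mul
      (hasDerivAt_exp_smul_const (𝕂 := ℝ) B 0)).sub (hasDerivAt_exp_smul_const (𝕂 := ℝ) (A + B) 0)
    exact h.congr_deriv (by simp)
  have hf0 : f 0 = 0 := by simp [hf]
  have hinv : Tendsto (fun n : ℕ => ((n : ℝ)⁻¹)) atTop (𝓝[≠] 0) :=
    tendsto_nhdsWithin_iff.2 ⟨tendsto_inv_atTop_nhds_zero_nat,
      (eventually_gt_atTop 0).mono fun n hn => by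
        simp only [Set.mem_compl_iff, Set.mem_singleton_iff, inv_eq_zero]; positivity⟩
  have hslope : Tendsto (fun n : ℕ => (n : ℝ) • f (n : ℝ)⁻¹) atTop (𝓝 0) := by
    have := (hasDerivAt_iff_tendsto_slope.1 hderiv).comp hinv
    refine this.congr fun n => ?_
    simp [slope, hf0]
  set C := ‖A‖ + ‖B‖ with hC
  have hbound : Tendsto (fun n : ℕ => Real.exp C * ‖(n : ℝ) • f (n : ℝ)⁻¹‖) atTop (𝓝 0) := by
    simpa using hslope.norm.const_mul (Real.exp C)
  rw [tendsto_iff_norm_sub_tendsto_zero]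
  refine squeeze_zero' (Eventually.of_forall fun _ => norm_nonneg _) ?_ hbound
  filter_upwards [eventually_gt_atTop 0] with n hn
  have hn' : (n : ℝ) ≠ 0 := by positivity
  have hsmul (X : 𝔸) : ‖(n : ℝ)⁻¹ • X‖ = (n : ℝ)⁻¹ * ‖X‖ := by
    rw [norm_smul, Real.norm_of_nonneg (by positivity)]
  have hexp : exp (A + B) = exp ((n : ℝ)⁻¹ • (A + B)) ^ n := by
    let _ : NormedAlgebra ℚ 𝔸 := NormedAlgebra.restrictScalars ℚ ℝ 𝔸
    rw [← NormedSpace.exp_nsmul, ← Nat.cast_smul_eq_nsmul ℝ, smul_smul, mul_inv_cancel₀ hn', one_smul]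
  have hM : 1 ≤ Real.exp ((n : ℝ)⁻¹ * C) := Real.one_le_exp (by positivity)
  have hx : ‖exp ((n : ℝ)⁻¹ • A) * exp ((n : ℝ)⁻¹ • B)‖ ≤ Real.exp ((n : ℝ)⁻¹ * C) := by
    refine (norm_mul_le _ _).trans ?_
    rw [hC, mul_add, Real.exp_add, ← hsmul, ← hsmul]
    gcongr <;> exact norm_exp_le_exp_norm _
  have hy : ‖exp ((n : ℝ)⁻¹ • (A + B))‖ ≤ Real.exp ((n : ℝ)⁻¹ * C) := by
    refine (norm_exp_le_exp_norm _).trans ?_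
    rw [hsmul]
    gcongr
    exact norm_add_le A B
  rw [hexp]
  refine (norm_pow_sub_pow_le hM hx hy n).trans_eq ?_
  rw [← Real.exp_nat_mul, mul_inv_cancel_left₀ hn', norm_smul, Real.norm_of_nonneg (by positivity)]
  ring

end LieTrotter

section GoldenThompson

variable {n : Type*} [Fintype n] [DecidableEq n]

theorem trace_mul_pow_comm (X Y : Matrix n n ℝ) (m : ℕ) :
    ((X * Y) ^ m).trace = ((Y * X) ^ m).trace := by
  cases m with
  | zero => simp
  | succ m =>
    have h : Y * (X * Y) ^ m = (Y * X) ^ m * Y :=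
      (SemiconjBy.pow_right (show SemiconjBy Y (X * Y) (Y * X) from (mul_assoc _ _ _).symm) m)
    rw [pow_succ', mul_assoc, Matrix.trace_mul_comm, h, mul_assoc, ← pow_succ]

theorem trace_mul_le_half_add {X Y : Matrix n n ℝ} (hX : X.IsHermitian) (hY : Y.IsHermitian) :
    (X * Y).trace ≤ ((X ^ 2).trace + (Y ^ 2).trace) / 2 := by
  have h := (posSemidef_conjTranspose_mul_self (X - Y)).trace_nonneg
  rw [(hX.sub hY).eq, sub_mul, mul_sub, mul_sub, trace_sub, trace_sub, trace_sub,
    Matrix.trace_mul_comm Y X] at h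
  rw [sq, sq]
  linarith

/-- Both trace inequalities are proved by one simultaneous induction. -/
theorem trace_pow_two_pow_le_aux (m : ℕ) :
    (∀ M : Matrix n n ℝ, (M ^ 2 ^ (m + 1)).trace ≤ ((M * Mᴴ) ^ 2 ^ m).trace) ∧
    (∀ A B : Matrix n n ℝ, A.IsHermitian → B.IsHermitian →
      ((A * B) ^ 2 ^ m).trace ≤ (A ^ 2 ^ m * B ^ 2 ^ m).trace) := by
  induction m with
  | zero =>
    refine ⟨fun M => ?_, fun A B _ _ => by simp⟩
    have h := (posSemidef_conjTranspose_mul_self (M - Mᴴ)).trace_nonneg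
    have h2 : (Mᴴ * Mᴴ).trace = (M * M).trace := by
      rw [← conjTranspose_mul, trace_conjTranspose, star_trivial]
    rw [conjTranspose_sub, conjTranspose_conjTranspose, sub_mul, mul_sub, mul_sub, trace_sub,
      trace_sub, trace_sub, Matrix.trace_mul_comm Mᴴ M, h2] at h
    simp only [zero_add, pow_one, pow_zero, sq]
    linarith
  | succ m ih =>
    obtain ⟨ihW, ihG⟩ := ih
    constructor
    · intro M
      have hP : (Mᴴ * M).IsHermitian := isHermitian_conjTranspose_mul_self M
      have hQ : (M * Mᴴ).IsHermitian := isHermitian_mul_conjTranspose_self M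
      calc (M ^ 2 ^ (m + 1 + 1)).trace = ((M ^ 2) ^ 2 ^ (m + 1)).trace := by
            rw [← pow_mul, ← pow_succ']
        _ ≤ ((M ^ 2 * (M ^ 2)ᴴ) ^ 2 ^ m).trace := ihW _
        _ = (((Mᴴ * M) * (M * Mᴴ)) ^ 2 ^ m).trace := by
            rw [show M ^ 2 * (M ^ 2)ᴴ = (M * (M * Mᴴ)) * Mᴴ by
              rw [sq, conjTranspose_mul]; noncomm_ring, trace_mul_pow_comm, ← mul_assoc]
        _ ≤ ((Mᴴ * M) ^ 2 ^ m * (M * Mᴴ) ^ 2 ^ m).trace := ihG _ _ hP hQ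
        _ ≤ (((((Mᴴ * M) ^ 2 ^ m) ^ 2).trace) + (((M * Mᴴ) ^ 2 ^ m) ^ 2).trace) / 2 :=
            trace_mul_le_half_add (hP.pow _) (hQ.pow _)
        _ = ((M * Mᴴ) ^ 2 ^ (m + 1)).trace := by
            rw [← pow_mul, ← pow_mul, ← pow_succ, trace_mul_pow_comm Mᴴ M]; ring
    · intro A B hA hB
      calc ((A * B) ^ 2 ^ (m + 1)).trace ≤ (((A * B) * (A * B)ᴴ) ^ 2 ^ m).trace := ihW _
        _ = ((A ^ 2 * B ^ 2) ^ 2 ^ m).trace := by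
            rw [conjTranspose_mul, hA.eq, hB.eq, ← mul_assoc, trace_mul_pow_comm]
            congr 2; noncomm_ring
        _ ≤ ((A ^ 2) ^ 2 ^ m * (B ^ 2) ^ 2 ^ m).trace := ihG _ _ (hA.pow _) (hB.pow _)
        _ = (A ^ 2 ^ (m + 1) * B ^ 2 ^ (m + 1)).trace := by
            rw [← pow_mul, ← pow_mul, ← pow_succ']

open scoped Matrix.Norms.L2Operator in
/-- The Golden–Thompson inequality for real symmetric matrices. -/
theorem trace_exp_add_le {A B : Matrix n n ℝ} (hA : A.IsHermitian) (hB : B.IsHermitian) :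
    (exp (A + B)).trace ≤ (exp A * exp B).trace := by
  cases isEmpty_or_nonempty n
  · simp [Matrix.trace]
  have hlim := (tendsto_exp_mul_exp_pow A B).comp (tendsto_pow_atTop_atTop_of_one_lt one_lt_two)
  have htr := (Continuous.matrix_trace continuous_id).continuousAt.tendsto.comp hlim
  refine le_of_tendsto htr (Eventually.of_forall fun m => ?_)
  have hscale (X : Matrix n n ℝ) : exp ((((2 ^ m : ℕ) : ℝ))⁻¹ • X) ^ 2 ^ m = exp X := by
    rw [← Matrix.exp_nsmul, ← Nat.cast_smul_eq_nsmul ℝ, smul_smul,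
      mul_inv_cancel₀ (by positivity), one_smul]
  have h := (trace_pow_two_pow_le_aux m).2 _ _
    (hA.smul (IsSelfAdjoint.all (((2 ^ m : ℕ) : ℝ)⁻¹))).exp
    (hB.smul (IsSelfAdjoint.all (((2 ^ m : ℕ) : ℝ)⁻¹))).exp
  rw [hscale, hscale] at h
  exact h

end GoldenThompson

section ScalarBound

theorem Real.monotone_two_add_sub_exp_mul_two_sub :
    Monotone fun t : ℝ => 2 + t - Real.exp t * (2 - t) := by
  have hd (t : ℝ) : HasDerivAt (fun t : ℝ => 2 + t - Real.exp t * (2 - t))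
      (1 - Real.exp t * (1 - t)) t := by
    refine (((hasDerivAt_id t).const_add 2).sub
      ((Real.hasDerivAt_exp t).mul ((hasDerivAt_id t).const_sub 2))).congr_deriv ?_
    simp only [id]
    ring
  refine monotone_of_deriv_nonneg (fun t => (hd t).differentiableAt) fun t => ?_
  rw [(hd t).deriv, sub_nonneg]
  have h : 1 - t ≤ Real.exp (-t) := by linarith [Real.add_one_le_exp (-t)]
  calc Real.exp t * (1 - t) ≤ Real.exp t * Real.exp (-t) := by gcongr
    _ = 1 := by rw [← Real.exp_add, add_neg_cancel, Real.exp_zero]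

theorem Real.exp_mul_one_sub_third_le (t : ℝ) :
    Real.exp t * (1 - t / 3) ≤ 1 + 2 * t / 3 + t ^ 2 / 6 := by
  set f : ℝ → ℝ := fun t => 1 + 2 * t / 3 + t ^ 2 / 6 - Real.exp t * (1 - t / 3) with hf
  have hd (t : ℝ) : HasDerivAt f ((2 + t - Real.exp t * (2 - t)) / 3) t := by
    refine ((((((hasDerivAt_id t).const_mul 2).div_const 3).const_add 1).add
      (((hasDerivAt_id t).pow 2).div_const 6)).sub
      ((Real.hasDerivAt_exp t).mul (((hasDerivAt_id t).div_const 3).const_sub 1))).congr_deriv ?_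
    simp only [id]
    ring
  have hcont : Continuous f := continuous_iff_continuousAt.2 fun t => (hd t).continuousAt
  suffices h : f 0 ≤ f t by
    simp only [hf] at h
    norm_num at h
    linarith
  rcases le_total 0 t with ht | ht
  · refine monotoneOn_of_deriv_nonneg (convex_Ici 0) hcont.continuousOn
      (fun x _ => (hd x).differentiableAt.differentiableWithinAt) (fun x hx => ?_)
      Set.self_mem_Ici ht ht
    rw [interior_Ici, Set.mem_Ioi] at hx
    have := Real.monotone_two_add_sub_exp_mul_two_sub hx.le
    norm_num at this
    rw [(hd x).deriv]
    linarith
  · refine antitoneOn_of_deriv_nonpos (convex_Iic 0) hcont.continuousOn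
      (fun x _ => (hd x).differentiableAt.differentiableWithinAt) (fun x hx => ?_)
      ht Set.self_mem_Iic ht
    rw [interior_Iic, Set.mem_Iio] at hx
    have := Real.monotone_two_add_sub_exp_mul_two_sub hx.le
    norm_num at this
    rw [(hd x).deriv]
    linarith

/-- The scalar Bernstein bound. -/
theorem Real.exp_le_bernstein {t a : ℝ} (hta : t ≤ a) (ha : a < 3) :
    Real.exp t ≤ 1 + t + 1 / (2 * (1 - a / 3)) * t ^ 2 := by
  have ht : 0 < 1 - t / 3 := by linarith
  have ha' : 0 < 1 - a / 3 := by linarith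
  calc Real.exp t ≤ (1 + 2 * t / 3 + t ^ 2 / 6) / (1 - t / 3) := by
        rw [le_div_iff₀ ht]
        exact Real.exp_mul_one_sub_third_le t
    _ = 1 + t + 1 / (2 * (1 - t / 3)) * t ^ 2 := by
        have : 3 - t ≠ 0 := by linarith
        field_simp
        ring
    _ ≤ 1 + t + 1 / (2 * (1 - a / 3)) * t ^ 2 := by gcongr

end ScalarBound

section Spectral

variable {n : Type*} [Fintype n] [DecidableEq n]

theorem Matrix.IsHermitian.eq_unitary_mul_diagonal_mul {A : Matrix n n ℝ} (hA : A.IsHermitian) :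
    A = (hA.eigenvectorUnitary : Matrix n n ℝ) * diagonal hA.eigenvalues *
      (hA.eigenvectorUnitary : Matrix n n ℝ)ᴴ := by
  conv_lhs => rw [hA.spectral_theorem]
  rw [Unitary.conjStarAlgAut_apply]
  rfl

theorem Matrix.IsHermitian.exp_smul_eq_unitary_mul_diagonal_mul {A : Matrix n n ℝ}
    (hA : A.IsHermitian) (c : ℝ) :
    NormedSpace.exp (c • A) = (hA.eigenvectorUnitary : Matrix n n ℝ) *
      diagonal (fun i => Real.exp (c * hA.eigenvalues i)) *
      (hA.eigenvectorUnitary : Matrix n n ℝ)ᴴ := by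
  have hU : (hA.eigenvectorUnitary : Matrix n n ℝ) * (hA.eigenvectorUnitary : Matrix n n ℝ)ᴴ = 1 :=
    Unitary.coe_mul_star_self hA.eigenvectorUnitary
  have hinv := Matrix.inv_eq_right_inv hU
  conv_lhs => enter [1, 2]; rw [hA.eq_unitary_mul_diagonal_mul]
  rw [← smul_mul_assoc, ← mul_smul_comm, ← diagonal_smul, ← hinv,
    Matrix.exp_conj _ _ (IsUnit.of_mul_eq_one _ hU), Matrix.exp_diagonal]
  congr 3
  funext i
  rw [Pi.coe_exp, Real.exp_eq_exp_ℝ, Pi.smul_apply, smul_eq_mul]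

theorem Matrix.IsHermitian.trace_exp_smul {A : Matrix n n ℝ} (hA : A.IsHermitian) (c : ℝ) :
    (NormedSpace.exp (c • A)).trace = ∑ i, Real.exp (c * hA.eigenvalues i) := by
  have hU : (hA.eigenvectorUnitary : Matrix n n ℝ)ᴴ * (hA.eigenvectorUnitary : Matrix n n ℝ) = 1 :=
    Unitary.coe_star_mul_self hA.eigenvectorUnitary
  rw [hA.exp_smul_eq_unitary_mul_diagonal_mul, Matrix.trace_mul_comm, ← mul_assoc, hU, one_mul,
    trace_diagonal]

theorem Matrix.IsHermitian.eigenvalues_le {A : Matrix n n ℝ} (hA : A.IsHermitian) {a : ℝ}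
    (h : (a • (1 : Matrix n n ℝ) - A).PosSemidef) (i : n) : hA.eigenvalues i ≤ a := by
  have hU : (hA.eigenvectorUnitary : Matrix n n ℝ)ᴴ * (hA.eigenvectorUnitary : Matrix n n ℝ) = 1 :=
    Unitary.coe_star_mul_self hA.eigenvectorUnitary
  have h2 := h.conjTranspose_mul_mul_same (hA.eigenvectorUnitary : Matrix n n ℝ)
  have h3 : (hA.eigenvectorUnitary : Matrix n n ℝ)ᴴ * (a • (1 : Matrix n n ℝ) - A) *
      (hA.eigenvectorUnitary : Matrix n n ℝ) =
      a • (1 : Matrix n n ℝ) - diagonal hA.eigenvalues := by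
    conv_lhs => enter [1, 2, 2]; rw [hA.eq_unitary_mul_diagonal_mul]
    rw [mul_sub, sub_mul, mul_smul_comm, smul_mul_assoc, mul_one, hU,
      mul_assoc, mul_assoc, mul_assoc, hU, mul_one, ← mul_assoc, hU, one_mul]
  rw [h3] at h2
  have := h2.diag_nonneg (i := i)
  simpa using this

theorem Matrix.IsHermitian.posSemidef_bernstein {A : Matrix n n ℝ} (hA : A.IsHermitian) {a : ℝ}
    (h : (a • (1 : Matrix n n ℝ) - A).PosSemidef) (ha : a < 3) :
    (1 + A + (1 / (2 * (1 - a / 3))) • A ^ 2 - NormedSpace.exp A).PosSemidef := by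
  set g := 1 / (2 * (1 - a / 3)) with hg
  have hU : (hA.eigenvectorUnitary : Matrix n n ℝ)ᴴ * (hA.eigenvectorUnitary : Matrix n n ℝ) = 1 :=
    Unitary.coe_star_mul_self hA.eigenvectorUnitary
  have hU' : (hA.eigenvectorUnitary : Matrix n n ℝ) * (hA.eigenvectorUnitary : Matrix n n ℝ)ᴴ = 1 :=
    Unitary.coe_mul_star_self hA.eigenvectorUnitary
  have hD : (diagonal (fun i => 1 + hA.eigenvalues i + g * hA.eigenvalues i ^ 2 -
      Real.exp (hA.eigenvalues i))).PosSemidef :=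
    PosSemidef.diagonal fun i => sub_nonneg.2 (Real.exp_le_bernstein (hA.eigenvalues_le h i) ha)
  have hsq : A ^ 2 = (hA.eigenvectorUnitary : Matrix n n ℝ) *
      diagonal (fun i => hA.eigenvalues i ^ 2) * (hA.eigenvectorUnitary : Matrix n n ℝ)ᴴ := by
    conv_lhs => rw [hA.eq_unitary_mul_diagonal_mul]
    simp only [sq, mul_assoc]
    rw [← mul_assoc _ᴴ, hU, one_mul, ← mul_assoc (diagonal _) (diagonal _), diagonal_mul_diagonal]
  have hdiag : diagonal (fun i => 1 + hA.eigenvalues i + g * hA.eigenvalues i ^ 2 -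
      Real.exp (hA.eigenvalues i)) = 1 + diagonal hA.eigenvalues +
      g • diagonal (fun i => hA.eigenvalues i ^ 2) -
      diagonal (fun i => Real.exp (hA.eigenvalues i)) := by
    ext i j
    by_cases hij : i = j
    · subst hij; simp
    · simp [hij]
  convert hD.mul_mul_conjTranspose_same (hA.eigenvectorUnitary : Matrix n n ℝ) using 1
  have hexp := hA.exp_smul_eq_unitary_mul_diagonal_mul 1
  simp only [one_smul, one_mul] at hexp
  rw [hdiag, hsq, hexp]
  conv_lhs => enter [1, 1, 2]; rw [hA.eq_unitary_mul_diagonal_mul]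
  rw [mul_sub, sub_mul, mul_add, add_mul, mul_add, add_mul, mul_one, hU', mul_smul_comm,
    smul_mul_assoc]

open scoped Matrix.Norms.L2Operator in
theorem Matrix.IsHermitian.exists_le_abs_eigenvalues {A : Matrix n n ℝ} (hA : A.IsHermitian)
    {ε : ℝ} (hε : 0 < ε) (h : ε ≤ ‖A‖) : ∃ i, ε ≤ |hA.eigenvalues i| := by
  by_contra! hlt
  have hdiag : ‖(diagonal hA.eigenvalues : Matrix n n ℝ)‖ < ε := by
    rw [Matrix.l2_opNorm_diagonal, pi_norm_lt_iff hε]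
    exact hlt
  have hnorm : ‖A‖ = ‖(diagonal hA.eigenvalues : Matrix n n ℝ)‖ := by
    conv_lhs => rw [hA.eq_unitary_mul_diagonal_mul]
    rw [← star_eq_conjTranspose, ← Unitary.coe_star, CStarRing.norm_mul_coe_unitary,
      CStarRing.norm_coe_unitary_mul]
  linarith

theorem Matrix.IsHermitian.trace_exp_mul_le {H N : Matrix n n ℝ} (hH : H.IsHermitian) {c : ℝ}
    (hN : (c • (1 : Matrix n n ℝ) - N).PosSemidef) :
    (NormedSpace.exp H * N).trace ≤ c * (NormedSpace.exp H).trace := by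
  have hhalf : NormedSpace.exp H = NormedSpace.exp ((2 : ℝ)⁻¹ • H) * NormedSpace.exp ((2 : ℝ)⁻¹ • H) := by
    rw [← sq, ← Matrix.exp_nsmul, ← Nat.cast_smul_eq_nsmul ℝ, smul_smul]
    norm_num
  have h := (hN.mul_mul_conjTranspose_same (NormedSpace.exp ((2 : ℝ)⁻¹ • H))).trace_nonneg
  rw [(hH.smul (IsSelfAdjoint.all (2 : ℝ)⁻¹)).exp.eq, Matrix.trace_mul_comm, ← mul_assoc,
    ← hhalf, mul_sub, trace_sub, mul_smul_comm, mul_one, trace_smul, smul_eq_mul] at h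
  linarith

end Spectral

section Bernstein

variable {n : Type*} [Fintype n] [DecidableEq n] {N : ℕ}

theorem expec_succ (p : Fin N → ℝ) (s : ℕ) (f : (Fin (s + 1) → Fin N) → ℝ) :
    expec p f = expec p fun ω : Fin s → Fin N => ∑ j, p j * f (Fin.cons j ω) := by
  unfold expec
  rw [← (Fin.consEquiv fun _ : Fin (s + 1) => Fin N).sum_comp, Fintype.sum_prod_type_right]
  refine Finset.sum_congr rfl fun ω _ => ?_
  rw [Finset.mul_sum]
  refine Finset.sum_congr rfl fun j _ => ?_
  simp only [Fin.consEquiv, Equiv.coe_fn_mk, Fin.prod_univ_succ, Fin.cons_zero, Fin.cons_succ]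
  ring

theorem expec_mono {p : Fin N → ℝ} (hp : ∀ j, 0 ≤ p j) {s : ℕ} {f g : (Fin s → Fin N) → ℝ}
    (h : ∀ ω, f ω ≤ g ω) : expec p f ≤ expec p g :=
  Finset.sum_le_sum fun ω _ =>
    mul_le_mul_of_nonneg_left (h ω) (Finset.prod_nonneg fun i _ => hp (ω i))

theorem expec_const_mul (p : Fin N → ℝ) {s : ℕ} (c : ℝ) (f : (Fin s → Fin N) → ℝ) :
    expec p (fun ω => c * f ω) = c * expec p f := by
  simp only [expec, Finset.mul_sum]
  exact Finset.sum_congr rfl fun ω _ => by ring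

theorem expec_add (p : Fin N → ℝ) {s : ℕ} (f g : (Fin s → Fin N) → ℝ) :
    expec p (fun ω => f ω + g ω) = expec p f + expec p g := by
  simp only [expec, mul_add, Finset.sum_add_distrib]

theorem Matrix.isHermitian_sum {m ι : Type*} (t : Finset ι) {Z : ι → Matrix m m ℝ}
    (hZ : ∀ j, (Z j).IsHermitian) : (∑ i ∈ t, Z i).IsHermitian := by
  rw [IsHermitian, conjTranspose_sum]
  exact Finset.sum_congr rfl fun i _ => hZ i

theorem expec_trace_exp_sum_le {p : Fin N → ℝ} (hp : ∀ j, 0 ≤ p j)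
    {Z : Fin N → Matrix n n ℝ} (hZ : ∀ j, (Z j).IsHermitian) {c : ℝ} (hc : 0 ≤ c)
    (h : (c • (1 : Matrix n n ℝ) - ∑ j, p j • exp (Z j)).PosSemidef) (s : ℕ) :
    expec p (fun ω : Fin s → Fin N => (exp (∑ i, Z (ω i))).trace) ≤ c ^ s * Fintype.card n := by
  induction s with
  | zero => simp [expec]
  | succ s ih =>
    rw [expec_succ]
    calc _ ≤ expec p (fun ω : Fin s → Fin N => c * (exp (∑ i, Z (ω i))).trace) := by
          refine expec_mono hp fun ω => ?_
          have hS : (∑ i, Z (ω i)).IsHermitian := isHermitian_sum _ fun i => hZ (ω i)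
          refine le_trans ?_ (hS.trace_exp_mul_le h)
          rw [Finset.mul_sum, trace_sum]
          refine Finset.sum_le_sum fun j _ => ?_
          rw [mul_smul_comm, trace_smul, smul_eq_mul]
          refine mul_le_mul_of_nonneg_left ?_ (hp j)
          rw [Fin.sum_univ_succ, add_comm]
          simp only [Fin.cons_zero, Fin.cons_succ]
          exact trace_exp_add_le hS (hZ j)
      _ = c * expec p (fun ω : Fin s → Fin N => (exp (∑ i, Z (ω i))).trace) :=
          expec_const_mul _ _ _
      _ ≤ c * (c ^ s * Fintype.card n) := by gcongr
      _ = c ^ (s + 1) * Fintype.card n := by ring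

/-- The trace moment generating function bound behind the matrix Bernstein inequality. -/
theorem expec_trace_exp_smul_sum_le {p : Fin N → ℝ} (hp : ∀ j, 0 ≤ p j) (hp1 : ∑ j, p j = 1)
    {X : Fin N → Matrix n n ℝ} (hX : ∀ j, (X j).IsHermitian) {L v θ : ℝ}
    (hL : ∀ j, (L • (1 : Matrix n n ℝ) - X j).PosSemidef) (hmean : ∑ j, p j • X j = 0)
    (hv : (v • (1 : Matrix n n ℝ) - ∑ j, p j • X j ^ 2).PosSemidef) (hv0 : 0 ≤ v)
    (hθ : 0 ≤ θ) (hθL : θ * L < 3) (s : ℕ) :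
    expec p (fun ω : Fin s → Fin N => (exp (θ • ∑ i, X (ω i))).trace) ≤
      Real.exp (s * (1 / (2 * (1 - θ * L / 3)) * θ ^ 2 * v)) * Fintype.card n := by
  set g := 1 / (2 * (1 - θ * L / 3)) with hg
  have hg0 : 0 ≤ g := by
    have : 0 < 1 - θ * L / 3 := by linarith
    positivity
  have hZ (j) : (θ • X j).IsHermitian := (hX j).smul (IsSelfAdjoint.all θ)
  have hZL (j) : ((θ * L) • (1 : Matrix n n ℝ) - θ • X j).PosSemidef := by
    rw [mul_smul, ← smul_sub]
    exact (hL j).smul hθ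
  have hmgf : ((1 + g * θ ^ 2 * v) • (1 : Matrix n n ℝ) -
      ∑ j, p j • exp (θ • X j)).PosSemidef := by
    have h1 := posSemidef_sum Finset.univ fun j _ =>
      ((hZ j).posSemidef_bernstein (hZL j) hθL).smul (hp j)
    have h2 := h1.add (hv.smul (mul_nonneg hg0 (sq_nonneg θ)))
    convert h2 using 1
    simp only [smul_sub, smul_add, Finset.sum_sub_distrib, Finset.sum_add_distrib, smul_pow,
      ← hg]
    have e1 : ∑ j, p j • (1 : Matrix n n ℝ) = 1 := by rw [← Finset.sum_smul, hp1, one_smul]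
    have e2 : ∑ j, p j • θ • X j = 0 := by
      simp_rw [smul_comm _ θ]
      rw [← Finset.smul_sum, hmean, smul_zero]
    have e3 : ∑ j, p j • g • θ ^ 2 • X j ^ 2 = (g * θ ^ 2) • ∑ j, p j • X j ^ 2 := by
      rw [Finset.smul_sum]
      refine Finset.sum_congr rfl fun j _ => ?_
      simp only [smul_smul]
      congr 1; ring
    rw [e1, e2, e3, add_smul, one_smul, smul_smul]
    abel
  have hc : (0 : ℝ) ≤ 1 + g * θ ^ 2 * v := by positivity
  have h := expec_trace_exp_sum_le hp hZ hc hmgf s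
  simp only [← Finset.smul_sum] at h
  refine h.trans ?_
  gcongr
  rw [Real.exp_nat_mul]
  gcongr
  linarith [Real.add_one_le_exp (g * θ ^ 2 * v)]

end Bernstein

section Sampling

theorem exp_mul_le_trace_exp_add_trace_exp {n : ℕ} {A : Matrix (Fin n) (Fin n) ℝ}
    (hA : A.IsHermitian) {ε θ : ℝ} (hε : 0 < ε) (hθ : 0 ≤ θ) (h : ε ≤ specNorm A) :
    Real.exp (θ * ε) ≤ (exp (θ • A)).trace + (exp (θ • -A)).trace := by
  obtain ⟨i, hi⟩ := hA.exists_le_abs_eigenvalues hε h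
  rw [smul_neg, ← neg_smul, hA.trace_exp_smul, hA.trace_exp_smul]
  have hnn (c : ℝ) : 0 ≤ ∑ i, Real.exp (c * hA.eigenvalues i) :=
    Finset.sum_nonneg fun i _ => (Real.exp_pos _).le
  have hle (c : ℝ) : Real.exp (c * hA.eigenvalues i) ≤ ∑ i, Real.exp (c * hA.eigenvalues i) :=
    Finset.single_le_sum (f := fun i => Real.exp (c * hA.eigenvalues i))
      (fun i _ => (Real.exp_pos _).le) (Finset.mem_univ i)
  rcases le_abs.1 hi with hi | hi
  · have : Real.exp (θ * ε) ≤ Real.exp (θ * hA.eigenvalues i) := by gcongr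
    linarith [hnn (-θ), hle θ]
  · have : Real.exp (θ * ε) ≤ Real.exp (-θ * hA.eigenvalues i) := by
      rw [neg_mul_comm]; gcongr
    linarith [hnn θ, hle (-θ)]

variable {N k : ℕ}

/-- A Markov-type inequality. -/
theorem mul_probOf_le_expec {p : Fin N → ℝ} (hp : ∀ j, 0 ≤ p j) {s : ℕ}
    {E : (Fin s → Fin N) → Prop} {f : (Fin s → Fin N) → ℝ} {c : ℝ} (hf : ∀ ω, 0 ≤ f ω)
    (h : ∀ ω, E ω → c ≤ f ω) : c * probOf p E ≤ expec p f := by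
  rw [probOf, expec, Finset.mul_sum]
  refine Finset.sum_le_sum fun ω _ => ?_
  have hprod : 0 ≤ ∏ i, p (ω i) := Finset.prod_nonneg fun i _ => hp (ω i)
  split_ifs with hE
  · rw [mul_comm]
    exact mul_le_mul_of_nonneg_left (h ω hE) hprod
  · rw [mul_zero]
    exact mul_nonneg hprod (hf ω)

/-- The centered rank-one summand obtained by sampling the row `j` of `Q`. -/
noncomputable def sampleDeviation (Q : Matrix (Fin N) (Fin k) ℝ) (p : Fin N → ℝ) (j : Fin N) :
    Matrix (Fin k) (Fin k) ℝ :=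
  (p j)⁻¹ • vecMulVec (Q j) (Q j) - 1

theorem posSemidef_vecMulVec_self (x : Fin k → ℝ) : (vecMulVec x x).PosSemidef := by
  simpa using posSemidef_vecMulVec_self_star x

theorem vecMulVec_mul_self (x : Fin k → ℝ) :
    vecMulVec x x * vecMulVec x x = (x ⬝ᵥ x) • vecMulVec x x := by
  rw [vecMulVec_mul_vecMulVec, vecMulVec_smul]

theorem posSemidef_smul_one_sub_vecMulVec {x : Fin k → ℝ} {c : ℝ} (h : x ⬝ᵥ x ≤ c) :
    (c • (1 : Matrix (Fin k) (Fin k) ℝ) - vecMulVec x x).PosSemidef := by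
  refine PosSemidef.of_dotProduct_mulVec_nonneg
    ((isHermitian_one.smul (IsSelfAdjoint.all c)).sub (posSemidef_vecMulVec_self x).isHermitian)
    fun y => ?_
  have hcs : (x ⬝ᵥ y) ^ 2 ≤ (x ⬝ᵥ x) * (y ⬝ᵥ y) := by
    have := Finset.sum_mul_sq_le_sq_mul_sq Finset.univ x y
    simpa only [dotProduct, sq] using this
  have hyy : 0 ≤ y ⬝ᵥ y := Finset.sum_nonneg fun i _ => mul_self_nonneg (y i)
  have hle := mul_le_mul_of_nonneg_right h hyy
  have heq : star y ⬝ᵥ ((c • (1 : Matrix (Fin k) (Fin k) ℝ) - vecMulVec x x) *ᵥ y) =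
      c * (y ⬝ᵥ y) - (x ⬝ᵥ y) ^ 2 := by
    rw [star_trivial, sub_mulVec, smul_mulVec, one_mulVec, vecMulVec_mulVec, dotProduct_sub,
      dotProduct_smul, smul_eq_mul]
    simp [dotProduct_comm y x, sq]
  rw [heq]
  linarith

theorem isHermitian_sampleDeviation (Q : Matrix (Fin N) (Fin k) ℝ) (p : Fin N → ℝ) (j : Fin N) :
    (sampleDeviation Q p j).IsHermitian :=
  ((posSemidef_vecMulVec_self (Q j)).isHermitian.smul (IsSelfAdjoint.all _)).sub isHermitian_one

theorem smul_sampleSquare_eq {Q : Matrix (Fin N) (Fin k) ℝ} {p : Fin N → ℝ} {L : ℝ}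
    (hlev : ∀ j, Q j ⬝ᵥ Q j ≤ L * p j) (j : Fin N) :
    p j • (p j)⁻¹ • vecMulVec (Q j) (Q j) = vecMulVec (Q j) (Q j) := by
  by_cases h0 : p j = 0
  · have hq : Q j = 0 := by
      have h := hlev j
      rw [h0, mul_zero] at h
      exact dotProduct_self_eq_zero.1
        (le_antisymm h (Finset.sum_nonneg fun i _ => mul_self_nonneg (Q j i)))
    simp [hq]
  · rw [smul_smul, mul_inv_cancel₀ h0, one_smul]

theorem sum_smul_sampleSquare {Q : Matrix (Fin N) (Fin k) ℝ} (hQ : Qᵀ * Q = 1) {p : Fin N → ℝ}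
    {L : ℝ} (hlev : ∀ j, Q j ⬝ᵥ Q j ≤ L * p j) :
    ∑ j, p j • (p j)⁻¹ • vecMulVec (Q j) (Q j) = 1 := by
  simp_rw [smul_sampleSquare_eq hlev]
  rw [← hQ]
  ext a b
  simp [Matrix.sum_apply, vecMulVec_apply, mul_apply]

theorem posSemidef_smul_one_sub_sampleDeviation {Q : Matrix (Fin N) (Fin k) ℝ} {p : Fin N → ℝ}
    (hp : ∀ j, 0 ≤ p j) {L : ℝ} (hL : 0 ≤ L) (hlev : ∀ j, Q j ⬝ᵥ Q j ≤ L * p j) (j : Fin N) :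
    (L • (1 : Matrix (Fin k) (Fin k) ℝ) - sampleDeviation Q p j).PosSemidef := by
  have h := ((posSemidef_smul_one_sub_vecMulVec (x := Q j) le_rfl).smul
    (inv_nonneg.2 (hp j))).add ((PosSemidef.one (n := Fin k) (R := ℝ)).smul
      (sub_nonneg.2 (inv_mul_le_of_le_mul₀ (hp j) hL (mul_comm L _ ▸ hlev j))))
  convert h.add PosSemidef.one using 1
  rw [sampleDeviation]
  module

theorem posSemidef_smul_one_sub_neg_sampleDeviation (Q : Matrix (Fin N) (Fin k) ℝ)
    {p : Fin N → ℝ} (hp : ∀ j, 0 ≤ p j) {L : ℝ} (hL : 1 ≤ L) (j : Fin N) :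
    (L • (1 : Matrix (Fin k) (Fin k) ℝ) - -sampleDeviation Q p j).PosSemidef := by
  convert ((posSemidef_vecMulVec_self (Q j)).smul (inv_nonneg.2 (hp j))).add
    ((PosSemidef.one (n := Fin k) (R := ℝ)).smul (sub_nonneg.2 hL)) using 1
  rw [sampleDeviation]
  module

theorem sum_smul_sampleDeviation {Q : Matrix (Fin N) (Fin k) ℝ} (hQ : Qᵀ * Q = 1) {p : Fin N → ℝ}
    (hp1 : ∑ j, p j = 1) {L : ℝ} (hlev : ∀ j, Q j ⬝ᵥ Q j ≤ L * p j) :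
    ∑ j, p j • sampleDeviation Q p j = 0 := by
  simp_rw [sampleDeviation, smul_sub, Finset.sum_sub_distrib]
  rw [sum_smul_sampleSquare hQ hlev, ← Finset.sum_smul, hp1, one_smul, sub_self]

theorem posSemidef_smul_one_sub_sum_sq {Q : Matrix (Fin N) (Fin k) ℝ} (hQ : Qᵀ * Q = 1)
    {p : Fin N → ℝ} (hp : ∀ j, 0 ≤ p j) (hp1 : ∑ j, p j = 1) {L : ℝ} (hL : 0 ≤ L)
    (hlev : ∀ j, Q j ⬝ᵥ Q j ≤ L * p j) :
    (L • (1 : Matrix (Fin k) (Fin k) ℝ) - ∑ j, p j • sampleDeviation Q p j ^ 2).PosSemidef := by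
  have hsum := posSemidef_sum Finset.univ fun j _ => (posSemidef_vecMulVec_self (Q j)).smul
    (mul_nonneg (hp j) (mul_nonneg (inv_nonneg.2 (hp j))
      (sub_nonneg.2 (inv_mul_le_of_le_mul₀ (hp j) hL (mul_comm L _ ▸ hlev j)))))
  convert hsum.add PosSemidef.one using 1
  have hterm (j) : (p j * ((p j)⁻¹ * (L - (p j)⁻¹ * (Q j ⬝ᵥ Q j)))) • vecMulVec (Q j) (Q j) =
      (L - 2) • (p j • (p j)⁻¹ • vecMulVec (Q j) (Q j)) + p j • (1 : Matrix (Fin k) (Fin k) ℝ) -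
        p j • sampleDeviation Q p j ^ 2 := by
    have hsq : sampleDeviation Q p j ^ 2 = ((p j)⁻¹ * ((p j)⁻¹ * (Q j ⬝ᵥ Q j))) •
        vecMulVec (Q j) (Q j) - (2 * (p j)⁻¹) • vecMulVec (Q j) (Q j) + 1 := by
      rw [sampleDeviation, sq, sub_mul, mul_sub, mul_one, one_mul, smul_mul_assoc, mul_smul_comm,
        vecMulVec_mul_self]
      module
    rw [hsq]
    module
  simp_rw [hterm]
  rw [Finset.sum_sub_distrib, Finset.sum_add_distrib, ← Finset.smul_sum,
    sum_smul_sampleSquare hQ hlev, ← Finset.sum_smul, hp1]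
  module

theorem samplingMatrix_gram_sub_one (Q : Matrix (Fin N) (Fin k) ℝ) {p : Fin N → ℝ}
    (hp : ∀ j, 0 ≤ p j) {s : ℕ} (hs : 0 < s) (ω : Fin s → Fin N) :
    ∑ i, sampleDeviation Q p (ω i) =
      (s : ℝ) • (Qᵀ * (samplingMatrix p s ω)ᵀ * samplingMatrix p s ω * Q - 1) := by
  have hs' : (s : ℝ) ≠ 0 := by positivity
  have hWQ (i : Fin s) (b : Fin k) :
      (samplingMatrix p s ω * Q) i b = 1 / Real.sqrt (s * p (ω i)) * Q (ω i) b := by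
    simp [mul_apply, samplingMatrix]
  have hsqrt (j : Fin N) : 1 / Real.sqrt (s * p j) * (1 / Real.sqrt (s * p j)) =
      (s : ℝ)⁻¹ * (p j)⁻¹ := by
    rw [div_mul_div_comm, Real.mul_self_sqrt (mul_nonneg (Nat.cast_nonneg s) (hp j)), one_mul,
      one_div, mul_inv]
  rw [← transpose_mul, Matrix.mul_assoc]
  ext a b
  simp only [sampleDeviation, Finset.sum_sub_distrib, Matrix.sub_apply, Matrix.sum_apply, Matrix.smul_apply,
    vecMulVec_apply, smul_eq_mul, mul_sub, mul_apply (M := (samplingMatrix p s ω * Q)ᵀ),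
    transpose_apply, hWQ, Finset.mul_sum, Finset.sum_const, Finset.card_univ, Fintype.card_fin,
    nsmul_eq_mul]
  congr 1
  refine Finset.sum_congr rfl fun i _ => ?_
  rw [mul_mul_mul_comm, hsqrt, mul_assoc (s : ℝ)⁻¹, mul_inv_cancel_left₀ hs']

/-- Sampling rows of a matrix with orthonormal columns preserves its Gram matrix with high
probability. -/
theorem probOf_specNorm_sampling_le {Q : Matrix (Fin N) (Fin k) ℝ} (hQ : Qᵀ * Q = 1)
    {p : Fin N → ℝ} (hp : ∀ j, 0 ≤ p j) (hp1 : ∑ j, p j = 1) {L : ℝ} (hL : 1 ≤ L)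
    (hlev : ∀ j, Q j ⬝ᵥ Q j ≤ L * p j) {s : ℕ} (hs : 0 < s) {ε : ℝ} (hε : 0 < ε) :
    probOf p (fun ω : Fin s → Fin N =>
        ε ≤ specNorm (Qᵀ * (samplingMatrix p s ω)ᵀ * samplingMatrix p s ω * Q - 1)) ≤
      2 * k * Real.exp (-(s * ε ^ 2 / (2 * L * (1 + ε / 3)))) := by
  have hL0 : 0 < L := by linarith
  have hs' : (0 : ℝ) < s := by positivity
  set θ := ε / (L * (1 + ε / 3)) with hθ
  have hθ0 : 0 ≤ θ := by positivity
  have hθL : θ * L = ε / (1 + ε / 3) := by rw [hθ]; field_simp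
  have hθL3 : θ * L < 3 := by
    rw [hθL, div_lt_iff₀ (by positivity)]
    linarith
  set K := s * (1 / (2 * (1 - θ * L / 3)) * θ ^ 2 * L) with hK
  have hKeq : K = s * ε ^ 2 / (2 * L * (1 + ε / 3)) := by
    have h3 : 1 - θ * L / 3 = 1 / (1 + ε / 3) := by rw [hθL]; field_simp; ring
    rw [hK, h3, hθ]
    field_simp
  set X := sampleDeviation Q p with hX
  have hmean := sum_smul_sampleDeviation hQ hp1 hlev
  have hvar := posSemidef_smul_one_sub_sum_sq hQ hp hp1 hL0.le hlev
  have hpos := expec_trace_exp_smul_sum_le hp hp1 (isHermitian_sampleDeviation Q p)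
    (posSemidef_smul_one_sub_sampleDeviation hp hL0.le hlev) hmean hvar hL0.le hθ0 hθL3 s
  have hneg := expec_trace_exp_smul_sum_le hp hp1 (fun j => (isHermitian_sampleDeviation Q p j).neg)
    (posSemidef_smul_one_sub_neg_sampleDeviation Q hp hL)
    (by simpa using hmean) (by simpa using hvar) hL0.le hθ0 hθL3 s
  rw [← hK, Fintype.card_fin] at hpos hneg
  have hS (ω : Fin s → Fin N) : (∑ i, X (ω i)).IsHermitian :=
    isHermitian_sum _ fun i => isHermitian_sampleDeviation Q p (ω i)
  have htr {A : Matrix (Fin k) (Fin k) ℝ} (hA : A.IsHermitian) : 0 ≤ (exp (θ • A)).trace := by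
    rw [hA.trace_exp_smul]
    exact Finset.sum_nonneg fun i _ => (Real.exp_pos _).le
  have hmarkov := mul_probOf_le_expec hp (c := Real.exp (θ * (s * ε)))
    (E := fun ω : Fin s → Fin N =>
      ε ≤ specNorm (Qᵀ * (samplingMatrix p s ω)ᵀ * samplingMatrix p s ω * Q - 1))
    (f := fun ω => (exp (θ • ∑ i, X (ω i))).trace + (exp (θ • ∑ i, -X (ω i))).trace)
    (fun ω => by
      rw [Finset.sum_neg_distrib]
      exact add_nonneg (htr (hS ω)) (htr (hS ω).neg))
    (fun ω hω => by
      rw [Finset.sum_neg_distrib]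
      refine exp_mul_le_trace_exp_add_trace_exp (hS ω) (by positivity) hθ0 ?_
      rw [hX, samplingMatrix_gram_sub_one Q hp hs ω, specNorm, map_smul, map_smul, norm_smul,
        Real.norm_of_nonneg hs'.le]
      gcongr
      exact hω)
  rw [expec_add] at hmarkov
  have htotal : Real.exp (θ * (s * ε)) * probOf p (fun ω : Fin s → Fin N =>
      ε ≤ specNorm (Qᵀ * (samplingMatrix p s ω)ᵀ * samplingMatrix p s ω * Q - 1)) ≤
      2 * k * Real.exp K := by linarith
  have hexp : θ * (s * ε) = K + K := by
    rw [hKeq, hθ]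
    field_simp
    ring
  rw [hexp, Real.exp_add, mul_assoc, mul_comm (Real.exp K)] at htotal
  rw [← hKeq, Real.exp_neg, ← div_eq_mul_inv, le_div_iff₀ (Real.exp_pos K)]
  refine le_of_mul_le_mul_right ?_ (Real.exp_pos K)
  linarith

end Sampling

section SVD

theorem transpose_firstCols_mul_firstCols {n r : ℕ} {U : Matrix (Fin n) (Fin r) ℝ}
    (hU : Uᵀ * U = 1) (k : ℕ) (h : k ≤ r) : (firstCols U k h)ᵀ * firstCols U k h = 1 := by
  ext a b
  have hab := congrFun (congrFun hU (Fin.castLE h a)) (Fin.castLE h b)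
  simp only [mul_apply, transpose_apply, one_apply, Fin.castLE_inj, firstCols] at hab ⊢
  exact hab

theorem sum_sum_sq_of_transpose_mul_self {n k : ℕ} {Q : Matrix (Fin n) (Fin k) ℝ}
    (hQ : Qᵀ * Q = 1) : ∑ i, ∑ j, Q i j ^ 2 = k := by
  have h := congrArg Matrix.trace hQ
  rw [trace_one, Fintype.card_fin] at h
  rw [← h, Finset.sum_comm]
  simp [Matrix.trace, mul_apply, sq]

theorem sub_truncated_ne_zero {n d r k : ℕ} {U : Matrix (Fin n) (Fin r) ℝ}
    {V : Matrix (Fin d) (Fin r) ℝ} {σ : Fin r → ℝ} (hU : Uᵀ * U = 1) (hV : Vᵀ * V = 1)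
    (hσ : ∀ i, 0 < σ i) (hkr : k < r) :
    U * diagonal σ * Vᵀ - U * truncDiag σ k * Vᵀ ≠ 0 := by
  intro h0
  rw [sub_eq_zero] at h0
  have hcancel (D : Matrix (Fin r) (Fin r) ℝ) : Uᵀ * (U * D * Vᵀ) * V = D := by
    rw [Matrix.mul_assoc, Matrix.mul_assoc, Matrix.mul_assoc, hV, Matrix.mul_one,
      ← Matrix.mul_assoc, hU, Matrix.one_mul]
  have hD : diagonal σ = truncDiag σ k := by rw [← hcancel (diagonal σ), h0, hcancel]
  have hkk := congrFun (congrFun hD ⟨k, hkr⟩) ⟨k, hkr⟩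
  simp only [truncDiag, diagonal_apply_eq, lt_irrefl, if_false] at hkk
  exact (hσ _).ne' hkk

theorem frobNorm_sq {m n : ℕ} (B : Matrix (Fin m) (Fin n) ℝ) :
    frobNorm B ^ 2 = ∑ i, ∑ j, B i j ^ 2 :=
  Real.sq_sqrt (Finset.sum_nonneg fun _ _ => Finset.sum_nonneg fun _ _ => sq_nonneg _)

theorem frobNorm_sq_ne_zero {m n : ℕ} {B : Matrix (Fin m) (Fin n) ℝ} (hB : B ≠ 0) :
    frobNorm B ^ 2 ≠ 0 := by
  rw [frobNorm_sq]
  contrapose! hB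
  ext i j
  have hi := (Finset.sum_eq_zero_iff_of_nonneg
    fun i _ => Finset.sum_nonneg fun j _ => sq_nonneg (B i j)).1 hB i (Finset.mem_univ i)
  have hij := (Finset.sum_eq_zero_iff_of_nonneg fun j _ => sq_nonneg (B i j)).1 hi j
    (Finset.mem_univ j)
  exact (pow_eq_zero_iff two_ne_zero).1 hij

end SVD

/-- leverage-score sampling satisfies the first structural condition. -/
theorem stmt_10 {n d r : ℕ} {k : ℕ} (s : ℕ) (hs : 0 < s)
    (A : Matrix (Fin n) (Fin d) ℝ)
    (U : Matrix (Fin n) (Fin r) ℝ) (V : Matrix (Fin d) (Fin r) ℝ) (σ : Fin r → ℝ)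
    (hU : Uᵀ * U = 1) (hV : Vᵀ * V = 1)
    (hσdec : ∀ i j : Fin r, i ≤ j → σ j ≤ σ i) (hσpos : ∀ i, 0 < σ i)
    (hA : A = U * Matrix.diagonal σ * Vᵀ) (hrank : A.rank = r)
    (hk1 : 1 ≤ k) (hkr : k < r)
    (p : Fin n → ℝ)
    (hpdef : ∀ i, p i =
        1 / 2 * ((∑ j, (firstCols U k hkr.le i j) ^ 2) / k)
      + 1 / 2 * ((∑ j, ((A - U * truncDiag σ k * Vᵀ) i j) ^ 2)
          / frobNorm (A - U * truncDiag σ k * Vᵀ) ^ 2))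
    (ε δ : ℝ) (hε0 : 0 < ε) (hε1 : ε < 1) (hδ0 : 0 < δ) (hδ1 : δ < 1)
    (hsbig : (s : ℝ) ≥ (1 + ε / 3) * (4 * k * Real.log (16 * (1 + k) / δ)) / ε ^ 2) :
    probOf p (fun (ω : Fin s → Fin n) =>
      ε ≤ specNorm ((firstCols U k hkr.le)ᵀ * (samplingMatrix p s ω)ᵀ
        * samplingMatrix p s ω * firstCols U k hkr.le - 1))
    ≤ δ / 4 := by
  set Q := firstCols U k hkr.le with hQdef
  set B := A - U * truncDiag σ k * Vᵀ with hBdef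
  have hQ : Qᵀ * Q = 1 := transpose_firstCols_mul_firstCols hU k hkr.le
  have hk : (1 : ℝ) ≤ k := by exact_mod_cast hk1
  have hk0 : (0 : ℝ) < k := by linarith
  have hB : frobNorm B ^ 2 ≠ 0 := by
    apply frobNorm_sq_ne_zero
    rw [hBdef, hA]
    exact sub_truncated_ne_zero hU hV hσpos hkr
  have hres (i) : 0 ≤ 1 / 2 * ((∑ j, B i j ^ 2) / frobNorm B ^ 2) := by positivity
  have hp (i) : 0 ≤ p i := by
    rw [hpdef i]
    have := hres i
    positivity
  have hp1 : ∑ i, p i = 1 := by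
    simp_rw [hpdef]
    rw [Finset.sum_add_distrib, ← Finset.mul_sum, ← Finset.mul_sum, ← Finset.sum_div,
      ← Finset.sum_div, sum_sum_sq_of_transpose_mul_self hQ, ← frobNorm_sq, div_self hk0.ne',
      div_self hB]
    norm_num
  have hlev (i) : Q i ⬝ᵥ Q i ≤ 2 * k * p i := by
    have hdot : Q i ⬝ᵥ Q i = ∑ j, Q i j ^ 2 := by simp only [dotProduct, sq]
    calc Q i ⬝ᵥ Q i = 2 * k * (1 / 2 * ((∑ j, Q i j ^ 2) / k)) := by
          rw [hdot]
          field_simp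
      _ ≤ 2 * k * p i := by
          rw [hpdef i]
          have := hres i
          gcongr
          linarith
  refine (probOf_specNorm_sampling_le hQ hp hp1 (by linarith) hlev hs hε0).trans ?_
  have hlog : Real.log (16 * (1 + k) / δ) ≤ s * ε ^ 2 / (2 * (2 * k) * (1 + ε / 3)) := by
    rw [ge_iff_le, div_le_iff₀ (by positivity)] at hsbig
    rw [le_div_iff₀ (by positivity)]
    linarith
  calc 2 * k * Real.exp (-(s * ε ^ 2 / (2 * (2 * k) * (1 + ε / 3))))
      ≤ 2 * k * Real.exp (-Real.log (16 * (1 + k) / δ)) := by gcongr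
    _ = 2 * k * (δ / (16 * (1 + k))) := by
        rw [Real.exp_neg, Real.exp_log (by positivity), inv_div]
    _ ≤ δ / 4 := by
        rw [← mul_div_assoc, div_le_div_iff₀ (by positivity) (by norm_num)]
        nlinarith
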